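/- Let L be a finite-dimensional nilpotent Lie superalgebra over a field F (char F ≠ 2,3) of superdimension (k | l) whose derived subalgebra L' = [L,L] has dimension one. Then L is capable if and only if either L ≅ H(1,0) ⊕ A(k−3 | l) or L ≅ H₁ ⊕ A(k−1 | l−2). -/

import Mathlib

/-!
Common definitions: Lie superalgebras over a field `F` (char ≠ 2,3 where needed),
graded ideals, centers, capability, epicenter, non-abelian tensor and exterior
products (characterized by generators-and-relations universal properties),
free Lie superalgebras, Schur multipliers, Heisenberg Lie superalgebras, etc.
-/

namespace SuperLie

open Submodule Function Module

universe u v w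

/-- The sign `(-1)^{|a||b|}` attached to a pair of `ℤ₂`-degrees. -/
def sg (F : Type u) [Field F] (a b : ZMod 2) : F := (-1 : F) ^ (a.val * b.val)

/-- A Lie superalgebra over `F`: a `ℤ₂`-graded vector space `L = L₀ ⊕ L₁`
together with an even bilinear bracket satisfying graded skew-symmetry and the
graded Jacobi identity (on homogeneous elements). -/
class LieSuper (F : Type u) [Field F] (L : Type v) [AddCommGroup L] [Module F L] where
  gr : ZMod 2 → Submodule F L
  isCompl_gr : IsCompl (gr 0) (gr 1)
  br : L → L → L
  br_add_left : ∀ x y z : L, br (x + y) z = br x z + br y z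
  br_add_right : ∀ x y z : L, br x (y + z) = br x y + br x z
  br_smul_left : ∀ (c : F) (x y : L), br (c • x) y = c • br x y
  br_smul_right : ∀ (c : F) (x y : L), br x (c • y) = c • br x y
  br_gr : ∀ a b : ZMod 2, ∀ x ∈ gr a, ∀ y ∈ gr b, br x y ∈ gr (a + b)
  br_skew : ∀ a b : ZMod 2, ∀ x ∈ gr a, ∀ y ∈ gr b, br x y = -(sg F a b) • br y x
  br_jacobi : ∀ a b c : ZMod 2, ∀ x ∈ gr a, ∀ y ∈ gr b, ∀ z ∈ gr c,
    sg F a c • br x (br y z) + sg F b a • br y (br z x) + sg F c b • br z (br x y) = 0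

/-- The `a`-graded piece of a Lie superalgebra. -/
def grd (F : Type u) [Field F] (L : Type v) [AddCommGroup L] [Module F L] [LieSuper F L]
    (a : ZMod 2) : Submodule F L :=
  LieSuper.gr a

/-- The bracket of a Lie superalgebra. -/
def sbr (F : Type u) [Field F] {L : Type v} [AddCommGroup L] [Module F L] [LieSuper F L]
    (x y : L) : L :=
  LieSuper.br (F := F) x y

/-- The center `Z(L) = {z ∈ L : [z,x] = 0 for all x ∈ L}`. -/
def centerS (F : Type u) [Field F] (L : Type v) [AddCommGroup L] [Module F L] [LieSuper F L] :
    Submodule F L where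
  carrier := {z : L | ∀ x : L, sbr F z x = 0}
  add_mem' := by
    intro a b ha hb x
    simp only [Set.mem_setOf_eq, sbr] at ha hb ⊢
    rw [LieSuper.br_add_left, ha x, hb x, add_zero]
  zero_mem' := by
    intro x
    have h := LieSuper.br_smul_left (F := F) (0 : F) (0 : L) x
    simp only [Set.mem_setOf_eq, sbr, zero_smul] at h ⊢
    simpa using h
  smul_mem' := by
    intro c a ha x
    simp only [Set.mem_setOf_eq, sbr] at ha ⊢
    rw [LieSuper.br_smul_left, ha x, smul_zero]

/-- Homomorphisms of Lie superalgebras: even (grading preserving) linear maps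
which preserve the bracket. -/
def IsHom (F : Type u) [Field F] {L : Type v} {M : Type w}
    [AddCommGroup L] [Module F L] [LieSuper F L]
    [AddCommGroup M] [Module F M] [LieSuper F M] (f : L →ₗ[F] M) : Prop :=
  (∀ a : ZMod 2, ∀ x ∈ grd F L a, f x ∈ grd F M a) ∧
  (∀ x y : L, f (sbr F x y) = sbr F (f x) (f y))

/-- A bundled Lie superalgebra over `F`. -/
structure LieSupAlg (F : Type u) [Field F] : Type (max u (v + 1)) where
  carrier : Type v
  [iag : AddCommGroup carrier]
  [imo : Module F carrier]
  [ils : LieSuper F carrier]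

attribute [instance] LieSupAlg.iag LieSupAlg.imo LieSupAlg.ils

instance (F : Type u) [Field F] : CoeSort (LieSupAlg.{u, v} F) (Type v) :=
  ⟨LieSupAlg.carrier⟩

/-- A Lie superalgebra `L` is capable if `L ≅ H/Z(H)` for some Lie superalgebra `H`,
i.e. there is a surjective homomorphism onto `L` whose kernel is exactly the center. -/
def Capable (F : Type u) [Field F] (L : Type v) [AddCommGroup L] [Module F L]
    [LieSuper F L] : Prop :=
  ∃ (H : LieSupAlg.{u, max u v} F) (φ : H.carrier →ₗ[F] L),
    IsHom F φ ∧ Surjective φ ∧ LinearMap.ker φ = centerS F H.carrier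

/-- Graded ideals of a Lie superalgebra. -/
def IsGIdeal (F : Type u) [Field F] {L : Type v} [AddCommGroup L] [Module F L]
    [LieSuper F L] (I : Submodule F L) : Prop :=
  (∀ x ∈ I, ∀ y : L, sbr F x y ∈ I) ∧ (∀ y : L, ∀ x ∈ I, sbr F y x ∈ I) ∧
  (∀ x ∈ I, ∃ x0 ∈ I ⊓ grd F L 0, ∃ x1 ∈ I ⊓ grd F L 1, x = x0 + x1)

/-- The graded ideal generated by a subset. -/
def idealClosure (F : Type u) [Field F] {L : Type v} [AddCommGroup L] [Module F L]
    [LieSuper F L] (S : Set L) : Submodule F L :=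
  sInf {I : Submodule F L | IsGIdeal F I ∧ S ⊆ ↑I}

/-- `QuotCapable F L N` expresses that the quotient Lie superalgebra `L/N` is capable. -/
def QuotCapable (F : Type u) [Field F] (L : Type v) [AddCommGroup L] [Module F L]
    [LieSuper F L] (N : Submodule F L) : Prop :=
  ∃ (Q : LieSupAlg.{u, max u v} F) (π : L →ₗ[F] Q.carrier),
    IsHom F π ∧ Surjective π ∧ LinearMap.ker π = N ∧ Capable F Q.carrier

/-- The epicenter `Z^*(L)`: the smallest graded ideal of `L` such that the
corresponding quotient is capable. -/
def IsEpicenter (F : Type u) [Field F] (L : Type v) [AddCommGroup L] [Module F L]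
    [LieSuper F L] (Z : Submodule F L) : Prop :=
  IsGIdeal F Z ∧ QuotCapable F L Z ∧
  ∀ N : Submodule F L, IsGIdeal F N → QuotCapable F L N → Z ≤ N

/-- The submodule `[I,J]` spanned by brackets. -/
def bracketSpan (F : Type u) [Field F] {L : Type v} [AddCommGroup L] [Module F L]
    [LieSuper F L] (I J : Submodule F L) : Submodule F L :=
  Submodule.span F {z : L | ∃ x ∈ I, ∃ y ∈ J, z = sbr F x y}

/-- The derived subalgebra `L' = [L,L]`. -/
def derived (F : Type u) [Field F] (L : Type v) [AddCommGroup L] [Module F L]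
    [LieSuper F L] : Submodule F L :=
  bracketSpan F (⊤ : Submodule F L) ⊤

/-- The lower central series of a Lie superalgebra. -/
def lowerCentral (F : Type u) [Field F] (L : Type v) [AddCommGroup L] [Module F L]
    [LieSuper F L] : ℕ → Submodule F L
  | 0 => ⊤
  | n + 1 => bracketSpan F (lowerCentral F L n) ⊤

/-- A Lie superalgebra is nilpotent if its lower central series terminates at zero. -/
def IsNilp (F : Type u) [Field F] (L : Type v) [AddCommGroup L] [Module F L]
    [LieSuper F L] : Prop :=
  ∃ n : ℕ, lowerCentral F L n = ⊥

/-- An action of a Lie superalgebra `P` on a Lie superalgebra `M`: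
an even bilinear map satisfying the two action axioms. -/
structure IsAction (F : Type u) [Field F] {P : Type v} {M : Type v}
    [AddCommGroup P] [Module F P] [LieSuper F P]
    [AddCommGroup M] [Module F M] [LieSuper F M] (act : P → M → M) : Prop where
  add_left : ∀ (p q : P) (m : M), act (p + q) m = act p m + act q m
  add_right : ∀ (p : P) (m m' : M), act p (m + m') = act p m + act p m'
  smul_left : ∀ (c : F) (p : P) (m : M), act (c • p) m = c • act p m
  smul_right : ∀ (c : F) (p : P) (m : M), act p (c • m) = c • act p m
  grade : ∀ a b : ZMod 2, ∀ p ∈ grd F P a, ∀ m ∈ grd F M b, act p m ∈ grd F M (a + b)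
  br_act : ∀ a b : ZMod 2, ∀ p ∈ grd F P a, ∀ p' ∈ grd F P b, ∀ m : M,
    act (sbr F p p') m = act p (act p' m) - sg F a b • act p' (act p m)
  act_br : ∀ a b : ZMod 2, ∀ p ∈ grd F P a, ∀ m ∈ grd F M b, ∀ m' : M,
    act p (sbr F m m') = sbr F (act p m) m' + sg F a b • sbr F m (act p m')

/-- Compatibility of mutual actions of two Lie superalgebras on each other. -/
def Compatible (F : Type u) [Field F] {M : Type v} {N : Type v}
    [AddCommGroup M] [Module F M] [LieSuper F M]
    [AddCommGroup N] [Module F N] [LieSuper F N]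
    (actMN : M → N → N) (actNM : N → M → M) : Prop :=
  (∀ a b : ZMod 2, ∀ m ∈ grd F M a, ∀ n ∈ grd F N b, ∀ n' : N,
      actMN (actNM n m) n' = -(sg F a b) • sbr F (actMN m n) n') ∧
  (∀ a b : ZMod 2, ∀ m ∈ grd F M a, ∀ n ∈ grd F N b, ∀ m' : M,
      actNM (actMN m n) m' = -(sg F a b) • sbr F (actNM n m) m')

/-- The defining relations of the non-abelian tensor product `M ⊗ N` of Lie
superalgebras (with given mutual actions), satisfied by a pairing `q` into `T`. -/
structure TensorRel (F : Type u) [Field F] {M : Type v} {N : Type v} {T : Type w}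
    [AddCommGroup M] [Module F M] [LieSuper F M]
    [AddCommGroup N] [Module F N] [LieSuper F N]
    [AddCommGroup T] [Module F T] [LieSuper F T]
    (actMN : M → N → N) (actNM : N → M → M) (q : M → N → T) : Prop where
  add_left : ∀ (m m' : M) (n : N), q (m + m') n = q m n + q m' n
  add_right : ∀ (m : M) (n n' : N), q m (n + n') = q m n + q m n'
  smul_left : ∀ (c : F) (m : M) (n : N), q (c • m) n = c • q m n
  smul_right : ∀ (c : F) (m : M) (n : N), q m (c • n) = c • q m n
  grade : ∀ a b : ZMod 2, ∀ m ∈ grd F M a, ∀ n ∈ grd F N b, q m n ∈ grd F T (a + b)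
  brk_left : ∀ a b : ZMod 2, ∀ m ∈ grd F M a, ∀ m' ∈ grd F M b, ∀ n : N,
    q (sbr F m m') n = q m (actMN m' n) - sg F a b • q m' (actMN m n)
  brk_right : ∀ a b c : ZMod 2, ∀ m ∈ grd F M a, ∀ n ∈ grd F N b, ∀ n' ∈ grd F N c,
    q m (sbr F n n') = sg F c (a + b) • q (actNM n' m) n - sg F a b • q (actNM n m) n'
  brk_brk : ∀ a b : ZMod 2, ∀ m ∈ grd F M a, ∀ n ∈ grd F N b, ∀ (m' : M) (n' : N),
    sbr F (q m n) (q m' n') = -(sg F a b) • q (actNM n m) (actMN m' n')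

/-- `IsTensorObj F actMN actNM t` says that `(T, t)` is the non-abelian tensor
product `M ⊗ N`: the pairing `t` satisfies the defining relations and is
universal among all pairings satisfying them. -/
structure IsTensorObj (F : Type u) [Field F] {M : Type v} {N : Type v} {T : Type v}
    [AddCommGroup M] [Module F M] [LieSuper F M]
    [AddCommGroup N] [Module F N] [LieSuper F N]
    [AddCommGroup T] [Module F T] [LieSuper F T]
    (actMN : M → N → N) (actNM : N → M → M) (t : M → N → T) : Prop where
  rel : TensorRel F actMN actNM t
  lift : ∀ (Q : LieSupAlg.{u, max u v} F) (q : M → N → Q.carrier),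
    TensorRel F actMN actNM q →
    ∃! h : T →ₗ[F] Q.carrier, IsHom F h ∧ ∀ (m : M) (n : N), h (t m n) = q m n

/-- The defining relations of the non-abelian exterior square `L ∧ L` of a Lie
superalgebra (the tensor relations for the bracket actions, together with the
graded alternating relations coming from `L □ L`). -/
structure ExtRel (F : Type u) [Field F] {L : Type v} {T : Type w}
    [AddCommGroup L] [Module F L] [LieSuper F L]
    [AddCommGroup T] [Module F T] [LieSuper F T] (q : L → L → T) : Prop where
  toTensor : TensorRel F (fun x y : L => sbr F x y) (fun x y : L => sbr F x y) q
  alt : ∀ a b : ZMod 2, ∀ x ∈ grd F L a, ∀ y ∈ grd F L b, q x y = -(sg F a b) • q y x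
  alt_even : ∀ x ∈ grd F L 0, q x x = 0

/-- `IsExtObj F t` says that `(E, t)` is the non-abelian exterior square `L ∧ L`. -/
structure IsExtObj (F : Type u) [Field F] {L : Type v} {E : Type v}
    [AddCommGroup L] [Module F L] [LieSuper F L]
    [AddCommGroup E] [Module F E] [LieSuper F E] (t : L → L → E) : Prop where
  rel : ExtRel F t
  lift : ∀ (Q : LieSupAlg.{u, max u v} F) (q : L → L → Q.carrier),
    ExtRel F q →
    ∃! h : E →ₗ[F] Q.carrier, IsHom F h ∧ ∀ x y : L, h (t x y) = q x y

/-- A free Lie superalgebra: free on some `ℤ₂`-graded subset `X`. -/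
def IsFreeLieSuper (F : Type u) [Field F] (Fr : Type v) [AddCommGroup Fr] [Module F Fr]
    [LieSuper F Fr] : Prop :=
  ∃ X : ZMod 2 → Set Fr,
    (∀ a : ZMod 2, X a ⊆ (grd F Fr a : Set Fr)) ∧
    ∀ (Q : LieSupAlg.{u, max u v} F) (f : ∀ a : ZMod 2, X a → Q.carrier),
      (∀ (a : ZMod 2) (x : X a), f a x ∈ grd F Q.carrier a) →
      ∃! h : Fr →ₗ[F] Q.carrier,
        IsHom F h ∧ ∀ (a : ZMod 2) (x : X a), h (x : Fr) = f a x

/-- `F' ∩ R`, for a free presentation with kernel `R`. -/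
abbrev schurA (F : Type u) [Field F] (Fr : Type v) [AddCommGroup Fr] [Module F Fr]
    [LieSuper F Fr] (R : Submodule F Fr) : Submodule F Fr :=
  derived F Fr ⊓ R

/-- The Schur multiplier `M(L) = (F' ∩ R)/[R,F]` attached to a free presentation
`0 → R → F → L → 0`. -/
abbrev SchurMul (F : Type u) [Field F] (Fr : Type v) [AddCommGroup Fr] [Module F Fr]
    [LieSuper F Fr] (R : Submodule F Fr) :=
  ↥(schurA F Fr R) ⧸ (Submodule.comap (schurA F Fr R).subtype (bracketSpan F R ⊤))

/-- `L` is (isomorphic to) the special Heisenberg Lie superalgebra `H(m,n)` with even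
center: basis `x₁,…,x_{2m}, z` (even), `y₁,…,y_n` (odd), with `[xᵢ, x_{m+i}] = z`,
`[y_j, y_j] = z` and `z` central. -/
def IsHeisE (F : Type u) [Field F] (m n : ℕ) (L : Type v) [AddCommGroup L] [Module F L]
    [LieSuper F L] : Prop :=
  ∃ (x : Fin (2 * m) → L) (y : Fin n → L) (z : L),
    (∀ i, x i ∈ grd F L 0) ∧ z ∈ grd F L 0 ∧ (∀ j, y j ∈ grd F L 1) ∧
    LinearIndependent F (Sum.elim x (Sum.elim y (fun _ : Unit => z))) ∧
    Submodule.span F (Set.range (Sum.elim x (Sum.elim y (fun _ : Unit => z)))) = ⊤ ∧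
    (∀ i j : Fin (2 * m), sbr F (x i) (x j) =
      if (j : ℕ) = (i : ℕ) + m then z else if (i : ℕ) = (j : ℕ) + m then -z else 0) ∧
    (∀ (i : Fin (2 * m)) (j : Fin n), sbr F (x i) (y j) = 0) ∧
    (∀ (i : Fin (2 * m)) (j : Fin n), sbr F (y j) (x i) = 0) ∧
    (∀ i j : Fin n, sbr F (y i) (y j) = if i = j then z else 0) ∧
    (∀ w : L, sbr F z w = 0) ∧ (∀ w : L, sbr F w z = 0)

/-- `L` is (isomorphic to) the Heisenberg Lie superalgebra `H_m` with odd center: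
basis `x₁,…,x_m` (even), `y₁,…,y_m, z` (odd), with `[x_j, y_j] = z` and `z` central. -/
def IsHeisO (F : Type u) [Field F] (m : ℕ) (L : Type v) [AddCommGroup L] [Module F L]
    [LieSuper F L] : Prop :=
  ∃ (x : Fin m → L) (y : Fin m → L) (z : L),
    (∀ i, x i ∈ grd F L 0) ∧ (∀ j, y j ∈ grd F L 1) ∧ z ∈ grd F L 1 ∧
    LinearIndependent F (Sum.elim x (Sum.elim y (fun _ : Unit => z))) ∧
    Submodule.span F (Set.range (Sum.elim x (Sum.elim y (fun _ : Unit => z)))) = ⊤ ∧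
    (∀ i j : Fin m, sbr F (x i) (x j) = 0) ∧
    (∀ i j : Fin m, sbr F (x i) (y j) = if i = j then z else 0) ∧
    (∀ i j : Fin m, sbr F (y j) (x i) = if i = j then -z else 0) ∧
    (∀ i j : Fin m, sbr F (y i) (y j) = 0) ∧
    (∀ w : L, sbr F z w = 0) ∧ (∀ w : L, sbr F w z = 0)

/-- `A` is (isomorphic to) the abelian Lie superalgebra `A(r | s)` of
superdimension `(r | s)`. -/
def IsAbelSuper (F : Type u) [Field F] (r s : ℕ) (A : Type v) [AddCommGroup A]
    [Module F A] [LieSuper F A] : Prop :=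
  (∀ x y : A, sbr F x y = 0) ∧ Module.Finite F A ∧
  Module.finrank F ↥(grd F A 0) = r ∧ Module.finrank F ↥(grd F A 1) = s

/-- The direct sum (product) of two Lie superalgebras. -/
instance prodLieSuper (F : Type u) [Field F] (A : Type v) (B : Type w)
    [AddCommGroup A] [Module F A] [LieSuper F A]
    [AddCommGroup B] [Module F B] [LieSuper F B] : LieSuper F (A × B) where
  gr a := (grd F A a).prod (grd F B a)
  isCompl_gr := by
    have hA : IsCompl (grd F A 0) (grd F A 1) := LieSuper.isCompl_gr
    have hB : IsCompl (grd F B 0) (grd F B 1) := LieSuper.isCompl_gr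
    constructor
    · rw [disjoint_iff, eq_bot_iff]
      rintro ⟨a, b⟩ h
      rw [Submodule.mem_inf] at h
      obtain ⟨h0, h1⟩ := h
      rw [Submodule.mem_prod] at h0 h1
      have ha : a = 0 := by
        have := hA.disjoint.le_bot (Submodule.mem_inf.mpr ⟨h0.1, h1.1⟩)
        simpa using this
      have hb : b = 0 := by
        have := hB.disjoint.le_bot (Submodule.mem_inf.mpr ⟨h0.2, h1.2⟩)
        simpa using this
      simp [ha, hb, Prod.ext_iff]
    · rw [codisjoint_iff, eq_top_iff]
      rintro ⟨a, b⟩ -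
      have ha' : a ∈ grd F A 0 ⊔ grd F A 1 := by
        rw [hA.codisjoint.eq_top]; trivial
      have hb' : b ∈ grd F B 0 ⊔ grd F B 1 := by
        rw [hB.codisjoint.eq_top]; trivial
      obtain ⟨a0, ha0, a1, ha1, rfl⟩ := Submodule.mem_sup.mp ha'
      obtain ⟨b0, hb0, b1, hb1, rfl⟩ := Submodule.mem_sup.mp hb'
      refine Submodule.mem_sup.mpr ⟨(a0, b0), ?_, (a1, b1), ?_, ?_⟩
      · exact Submodule.mem_prod.mpr ⟨ha0, hb0⟩
      · exact Submodule.mem_prod.mpr ⟨ha1, hb1⟩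
      · rfl
  br x y := (sbr F x.1 y.1, sbr F x.2 y.2)
  br_add_left := by
    intro x y z
    simp only [Prod.fst_add, Prod.snd_add, sbr, LieSuper.br_add_left]
    rfl
  br_add_right := by
    intro x y z
    simp only [Prod.fst_add, Prod.snd_add, sbr, LieSuper.br_add_right]
    rfl
  br_smul_left := by
    intro c x y
    simp only [Prod.smul_fst, Prod.smul_snd, sbr, LieSuper.br_smul_left]
    rfl
  br_smul_right := by
    intro c x y
    simp only [Prod.smul_fst, Prod.smul_snd, sbr, LieSuper.br_smul_right]
    rfl
  br_gr := by
    intro a b x hx y hy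
    rw [Submodule.mem_prod] at hx hy ⊢
    exact ⟨LieSuper.br_gr a b x.1 hx.1 y.1 hy.1, LieSuper.br_gr a b x.2 hx.2 y.2 hy.2⟩
  br_skew := by
    intro a b x hx y hy
    rw [Submodule.mem_prod] at hx hy
    have h1 := LieSuper.br_skew (F := F) a b x.1 hx.1 y.1 hy.1
    have h2 := LieSuper.br_skew (F := F) a b x.2 hx.2 y.2 hy.2
    simp only [sbr]
    rw [Prod.ext_iff]
    exact ⟨h1, h2⟩
  br_jacobi := by
    intro a b c x hx y hy z hz
    rw [Submodule.mem_prod] at hx hy hz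
    have h1 := LieSuper.br_jacobi (F := F) a b c x.1 hx.1 y.1 hy.1 z.1 hz.1
    have h2 := LieSuper.br_jacobi (F := F) a b c x.2 hx.2 y.2 hy.2 z.2 hz.2
    simp only [sbr]
    rw [Prod.ext_iff]
    exact ⟨h1, h2⟩


section Basics

variable {F : Type u} [Field F] {L : Type v} [AddCommGroup L] [Module F L] [LieSuper F L]

theorem sbr_add_left (x y z : L) : sbr F (x + y) z = sbr F x z + sbr F y z :=
  LieSuper.br_add_left x y z
theorem sbr_add_right (x y z : L) : sbr F x (y + z) = sbr F x y + sbr F x z :=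
  LieSuper.br_add_right x y z
theorem sbr_smul_left (c : F) (x y : L) : sbr F (c • x) y = c • sbr F x y :=
  LieSuper.br_smul_left c x y
theorem sbr_smul_right (c : F) (x y : L) : sbr F x (c • y) = c • sbr F x y :=
  LieSuper.br_smul_right c x y
theorem sbr_zero_left (y : L) : sbr F 0 y = 0 := by
  simpa using sbr_smul_left (0 : F) (0 : L) y
theorem sbr_zero_right (y : L) : sbr F y 0 = 0 := by
  simpa using sbr_smul_right (0 : F) y (0 : L)
theorem sbr_neg_left (x y : L) : sbr F (-x) y = -sbr F x y := by
  simpa using sbr_smul_left (-1 : F) x y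
theorem sbr_neg_right (x y : L) : sbr F x (-y) = -sbr F x y := by
  simpa using sbr_smul_right (-1 : F) x y
theorem sbr_sub_left (x y z : L) : sbr F (x - y) z = sbr F x z - sbr F y z := by
  rw [sub_eq_add_neg, sbr_add_left, sbr_neg_left, ← sub_eq_add_neg]
theorem sbr_sub_right (x y z : L) : sbr F x (y - z) = sbr F x y - sbr F x z := by
  rw [sub_eq_add_neg, sbr_add_right, sbr_neg_right, ← sub_eq_add_neg]

theorem sbr_gr {a b : ZMod 2} {x y : L} (hx : x ∈ grd F L a) (hy : y ∈ grd F L b) :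
    sbr F x y ∈ grd F L (a + b) := LieSuper.br_gr a b x hx y hy
theorem sbr_skew {a b : ZMod 2} {x y : L} (hx : x ∈ grd F L a) (hy : y ∈ grd F L b) :
    sbr F x y = -(sg F a b) • sbr F y x := LieSuper.br_skew a b x hx y hy

theorem z2 (a : ZMod 2) : a = 0 ∨ a = 1 := by revert a; decide

theorem sg_ne (a b : ZMod 2) : sg F a b ≠ 0 := by
  unfold sg; exact pow_ne_zero _ (by simp)
theorem sg_zero_left (b : ZMod 2) : sg F 0 b = 1 := by simp [sg]
theorem sg_zero_right (b : ZMod 2) : sg F b 0 = 1 := by simp [sg]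
theorem sg_one_one : sg F 1 1 = -1 := by
  have : (1 : ZMod 2).val = 1 := rfl
  simp [sg, this]

theorem gr_inter (a : ZMod 2) {x : L} (h1 : x ∈ grd F L a) (h2 : x ∈ grd F L (a + 1)) :
    x = 0 := by
  have hA : IsCompl (grd F L 0) (grd F L 1) := LieSuper.isCompl_gr
  have key : ∀ x : L, x ∈ grd F L 0 → x ∈ grd F L 1 → x = 0 := fun x h0 h1 => by
    simpa using hA.disjoint.le_bot (Submodule.mem_inf.mpr ⟨h0, h1⟩)
  rcases z2 a with rfl | rfl
  · exact key x h1 (by simpa using h2)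
  · exact key x (by simpa [show (1 : ZMod 2) + 1 = 0 from rfl] using h2) h1

variable (F) in
theorem gr_decomp (a : ZMod 2) (x : L) :
    ∃ u ∈ grd F L a, ∃ v ∈ grd F L (a + 1), x = u + v := by
  have hA : IsCompl (grd F L 0) (grd F L 1) := LieSuper.isCompl_gr
  have ha' : x ∈ grd F L 0 ⊔ grd F L 1 := by
    rw [hA.codisjoint.eq_top]; trivial
  obtain ⟨a0, ha0, a1, ha1, rfl⟩ := Submodule.mem_sup.mp ha'
  rcases z2 a with rfl | rfl
  · exact ⟨a0, ha0, a1, by simpa using ha1, rfl⟩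
  · exact ⟨a1, ha1, a0, by simpa [show (1 : ZMod 2) + 1 = 0 from rfl] using ha0, add_comm _ _⟩

theorem gr_sum_zero (a : ZMod 2) {u v : L} (hu : u ∈ grd F L a) (hv : v ∈ grd F L (a + 1))
    (h : u + v = 0) : u = 0 ∧ v = 0 := by
  have h1 : u = -v := eq_neg_of_add_eq_zero_left h
  have h2 : u = 0 := gr_inter (F := F) a hu (by rw [h1]; exact neg_mem hv)
  exact ⟨h2, by simpa [h2] using h⟩

theorem comm_zero_h {a b : ZMod 2} {x y : L} (hx : x ∈ grd F L a) (hy : y ∈ grd F L b)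
    (h : sbr F x y = 0) : sbr F y x = 0 := by
  rw [sbr_skew hy hx, h, smul_zero]

/-- homogeneous components of an element commuting with a homogeneous one -/
theorem comp_zero {a c : ZMod 2} {x u v : L} (hx : x ∈ grd F L a) (hu : u ∈ grd F L c)
    (hv : v ∈ grd F L (c + 1)) (h : sbr F x (u + v) = 0) :
    sbr F x u = 0 ∧ sbr F x v = 0 := by
  rw [sbr_add_right] at h
  refine gr_sum_zero (F := F) (a + c) (sbr_gr hx hu) ?_ h
  rw [add_assoc]; exact sbr_gr hx hv

theorem comp_zero' {a c : ZMod 2} {x u v : L} (hx : x ∈ grd F L a) (hu : u ∈ grd F L c)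
    (hv : v ∈ grd F L (c + 1)) (h : sbr F (u + v) x = 0) :
    sbr F u x = 0 ∧ sbr F v x = 0 := by
  rw [sbr_add_left] at h
  refine gr_sum_zero (F := F) (a + c) ?_ ?_ h
  · rw [add_comm]; exact sbr_gr hu hx
  · rw [add_assoc, add_comm]; exact sbr_gr hv hx

theorem comm_zero {a : ZMod 2} {x w : L} (hx : x ∈ grd F L a) (h : sbr F x w = 0) :
    sbr F w x = 0 := by
  obtain ⟨u, hu, v, hv, rfl⟩ := gr_decomp F 0 w
  obtain ⟨h1, h2⟩ := comp_zero hx hu hv h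
  rw [sbr_add_left, comm_zero_h hx hu h1, comm_zero_h hx hv h2, add_zero]

theorem comm_zero' {a : ZMod 2} {x w : L} (hx : x ∈ grd F L a) (h : sbr F w x = 0) :
    sbr F x w = 0 := by
  obtain ⟨u, hu, v, hv, rfl⟩ := gr_decomp F 0 w
  obtain ⟨h1, h2⟩ := comp_zero' hx hu hv h
  rw [sbr_add_right, comm_zero_h hu hx h1, comm_zero_h hv hx h2, add_zero]

theorem center_right {z : L} (hz : z ∈ centerS F L) (w : L) : sbr F w z = 0 := by
  obtain ⟨u, hu, v, hv, rfl⟩ := gr_decomp F 0 w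
  rw [sbr_add_left, comm_zero' hu (hz u), comm_zero' hv (hz v), add_zero]

variable {M : Type w} [AddCommGroup M] [Module F M] [LieSuper F M]

theorem hom_lift {φ : M →ₗ[F] L} (hφ : IsHom F φ) (hs : Surjective φ) {a : ZMod 2} {x : L}
    (hx : x ∈ grd F L a) : ∃ h ∈ grd F M a, φ h = x := by
  obtain ⟨h, rfl⟩ := hs x
  obtain ⟨u, hu, v, hv, rfl⟩ := gr_decomp F a h
  refine ⟨u, hu, ?_⟩
  have h1 : φ v = 0 := by
    refine gr_inter a ?_ (hφ.1 _ _ hv)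
    have := sub_mem hx (hφ.1 _ _ hu)
    simpa using this
  simp [h1]

theorem hom_symm {e : M ≃ₗ[F] L} (he : IsHom F e.toLinearMap) :
    IsHom F e.symm.toLinearMap := by
  constructor
  · intro a x hx
    obtain ⟨h, hh, rfl⟩ := hom_lift he e.surjective hx
    simpa using hh
  · intro x y
    apply e.injective
    have := he.2 (e.symm x) (e.symm y)
    simp only [LinearEquiv.coe_coe] at this ⊢
    rw [this]; simp

theorem capable_transfer {L M : Type v} [AddCommGroup L] [Module F L] [LieSuper F L]
    [AddCommGroup M] [Module F M] [LieSuper F M] {e : L ≃ₗ[F] M} (he : IsHom F e.toLinearMap)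
    (hM : Capable F M) : Capable F L := by
  obtain ⟨H, φ, hφ, hs, hk⟩ := hM
  have h2 := hom_symm he
  refine ⟨H, e.symm.toLinearMap ∘ₗ φ, ⟨?_, ?_⟩, ?_, ?_⟩
  · intro a x hx; exact h2.1 _ _ (hφ.1 _ _ hx)
  · intro x y
    simp only [LinearMap.comp_apply]
    rw [hφ.2, h2.2]
  · exact e.symm.surjective.comp hs
  · rw [← hk]; ext x; simp

end Basics

section Construct

variable {F : Type u} [Field F] {W : Type v} [AddCommGroup W] [Module F W]

/-- even line acting on `W × W` by `(w, w') ↦ (D w, w)` -/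
@[reducible] def extLS (Wg : ZMod 2 → Submodule F W) (hc : IsCompl (Wg 0) (Wg 1)) (D : W →ₗ[F] W)
    (hD : ∀ a, ∀ w ∈ Wg a, D w ∈ Wg a) : LieSuper F (F × W × W) where
  gr a := (if a = 0 then ⊤ else ⊥ : Submodule F F).prod ((Wg a).prod (Wg a))
  isCompl_gr := by
    constructor
    · rw [disjoint_iff, eq_bot_iff]
      rintro ⟨s, a, b⟩ h
      simp only [Submodule.mem_inf, Submodule.mem_prod] at h
      obtain ⟨⟨-, h1, h2⟩, h3, h4, h5⟩ := h
      have ha : a = 0 := by simpa using hc.disjoint.le_bot (Submodule.mem_inf.mpr ⟨h1, h4⟩)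
      have hb : b = 0 := by simpa using hc.disjoint.le_bot (Submodule.mem_inf.mpr ⟨h2, h5⟩)
      simp at h3
      simp [ha, hb, h3]
    · rw [codisjoint_iff, eq_top_iff]
      rintro ⟨s, a, b⟩ -
      have ha' : a ∈ Wg 0 ⊔ Wg 1 := by rw [hc.codisjoint.eq_top]; trivial
      have hb' : b ∈ Wg 0 ⊔ Wg 1 := by rw [hc.codisjoint.eq_top]; trivial
      obtain ⟨a0, ha0, a1, ha1, rfl⟩ := Submodule.mem_sup.mp ha'
      obtain ⟨b0, hb0, b1, hb1, rfl⟩ := Submodule.mem_sup.mp hb'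
      refine Submodule.mem_sup.mpr ⟨(s, a0, b0), ?_, (0, a1, b1), ?_, ?_⟩
      · simp [Submodule.mem_prod, ha0, hb0]
      · simp [Submodule.mem_prod, ha1, hb1]
      · simp
  br x y := (0, x.1 • D y.2.1 - y.1 • D x.2.1, x.1 • y.2.1 - y.1 • x.2.1)
  br_add_left := by
    intro x y z
    ext <;> simp <;> module
  br_add_right := by
    intro x y z
    ext <;> simp <;> module
  br_smul_left := by
    intro c x y
    ext <;> simp <;> module
  br_smul_right := by
    intro c x y
    ext <;> simp <;> module
  br_gr := by
    rintro a b ⟨s, w, w'⟩ hx ⟨t, v, v'⟩ hy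
    simp only [Submodule.mem_prod] at hx hy ⊢
    refine ⟨zero_mem _, ?_⟩
    rcases z2 a with rfl | rfl <;> rcases z2 b with rfl | rfl
    · simp only [add_zero]
      exact ⟨sub_mem (Submodule.smul_mem _ _ (hD _ _ hy.2.1)) (Submodule.smul_mem _ _ (hD _ _ hx.2.1)),
        sub_mem (Submodule.smul_mem _ _ hy.2.1) (Submodule.smul_mem _ _ hx.2.1)⟩
    · have ht : t = 0 := by simpa using hy.1
      subst ht
      simp only [zero_add, zero_smul, sub_zero]
      exact ⟨Submodule.smul_mem _ _ (hD _ _ hy.2.1), Submodule.smul_mem _ _ hy.2.1⟩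
    · have ht : s = 0 := by simpa using hx.1
      subst ht
      simp only [add_zero, zero_smul, zero_sub]
      exact ⟨neg_mem (Submodule.smul_mem _ _ (hD _ _ hx.2.1)), neg_mem (Submodule.smul_mem _ _ hx.2.1)⟩
    · have ht : s = 0 := by simpa using hx.1
      have ht : t = 0 := by simpa using hy.1
      subst s t
      simp
  br_skew := by
    rintro a b ⟨s, w, w'⟩ hx ⟨t, v, v'⟩ hy
    simp only [Submodule.mem_prod] at hx hy
    rcases z2 a with rfl | rfl
    · simp [sg_zero_left]
    rcases z2 b with rfl | rfl
    · simp [sg_zero_right]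
    · have hs : s = 0 := by simpa using hx.1
      have ht : t = 0 := by simpa using hy.1
      simp [hs, ht]
  br_jacobi := by
    rintro a b c ⟨s, w, w'⟩ hx ⟨t, v, v'⟩ hy ⟨r, u, u'⟩ hz
    simp only [Submodule.mem_prod] at hx hy hz
    rcases z2 a with rfl | rfl <;> rcases z2 b with rfl | rfl <;> rcases z2 c with rfl | rfl <;>
    simp only [sg_zero_left, sg_zero_right, sg_one_one] <;>
    simp at hx hy hz <;> ext <;> simp [hx, hy, hz] <;> module

theorem capable_of_split {L : Type v} [AddCommGroup L] [Module F L] [LieSuper F L]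
    (x : L) (hx : x ∈ grd F L 0) (W : Submodule F L)
    (hW : ∀ u ∈ grd F L 0, ∀ v ∈ grd F L 1, u + v ∈ W → u ∈ W ∧ v ∈ W)
    (hab : ∀ u ∈ W, ∀ v ∈ W, sbr F u v = 0)
    (hxx : sbr F x x = 0)
    (hxW : ∀ u ∈ W, sbr F x u ∈ W)
    (hsp : ∀ m : L, ∃ s : F, ∃ w ∈ W, m = s • x + w)
    (hind : ∀ s : F, s • x ∈ W → s = 0)
    (hne : ∃ w ∈ W, w ≠ 0) : Capable F L := by
  have hneg : ∀ u : L, sbr F u x = - sbr F x u := by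
    intro u
    obtain ⟨p, hp, q, hq, rfl⟩ := gr_decomp F 0 u
    rw [sbr_add_left, sbr_skew hp hx, sbr_skew hq hx, sg_zero_right, sg_zero_right, sbr_add_right]
    module
  let Wg : ZMod 2 → Submodule F W := fun a => (grd F L a).comap W.subtype
  have hc : IsCompl (Wg 0) (Wg 1) := by
    constructor
    · rw [disjoint_iff, eq_bot_iff]
      rintro ⟨w, hw⟩ h
      rw [Submodule.mem_inf] at h
      have : w = 0 := gr_inter 0 h.1 (by rw [zero_add]; exact h.2)
      simpa using this
    · rw [codisjoint_iff, eq_top_iff]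
      rintro ⟨w, hw⟩ -
      obtain ⟨u, hu, v, hv, rfl⟩ := gr_decomp F 0 w
      rw [zero_add] at hv
      obtain ⟨h1, h2⟩ := hW u hu v hv hw
      exact Submodule.mem_sup.mpr ⟨⟨u, h1⟩, hu, ⟨v, h2⟩, hv, rfl⟩
  let D : W →ₗ[F] W :=
    { toFun := fun w => ⟨sbr F x w, hxW w w.2⟩
      map_add' := fun u v => Subtype.ext (sbr_add_right _ _ _)
      map_smul' := fun c u => Subtype.ext (sbr_smul_right _ _ _) }
  have hDc : ∀ w : W, ((D w : W) : L) = sbr F x w := fun w => rfl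
  have hD : ∀ a, ∀ w ∈ Wg a, D w ∈ Wg a := by
    intro a w hw
    have := sbr_gr hx (show (w : L) ∈ grd F L a from hw)
    rwa [zero_add] at this
  let H : LieSupAlg.{u, max u v} F :=
    { carrier := F × W × W
      ils := extLS Wg hc D hD }
  let φ : (F × W × W) →ₗ[F] L :=
    (LinearMap.toSpanSingleton F L x).coprod (W.subtype ∘ₗ LinearMap.fst F W W)
  have hφ : ∀ s w w', φ (s, w, w') = s • x + (w : L) := by
    intro s w w'; simp [φ]
  have hbr : ∀ p q : F × W × W, @sbr F _ H.carrier H.iag H.imo H.ils p q =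
    ((0, p.1 • D q.2.1 - q.1 • D p.2.1, p.1 • q.2.1 - q.1 • p.2.1) : F × W × W) := fun p q => rfl
  refine ⟨H, φ, ⟨?_, ?_⟩, ?_, ?_⟩
  · rintro a ⟨s, w, w'⟩ h
    obtain ⟨h1, h2, h3⟩ := h
    rw [hφ]
    refine add_mem ?_ h2
    rcases z2 a with rfl | rfl
    · exact Submodule.smul_mem _ _ hx
    · have hs : s = 0 := by simpa using h1
      simp [hs]
  · rintro ⟨s, w, w'⟩ ⟨t, v, v'⟩
    rw [hbr, hφ, hφ, hφ]
    simp only [sbr_add_left, sbr_add_right, sbr_smul_left, sbr_smul_right, hxx,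
      hab _ w.2 _ v.2, hneg w]
    push_cast
    simp only [hDc]
    module
  · intro m
    obtain ⟨s, w, hw, rfl⟩ := hsp m
    exact ⟨(s, ⟨w, hw⟩, 0), by rw [hφ]⟩
  · ext ⟨s, w, w'⟩
    rw [LinearMap.mem_ker, hφ]
    constructor
    · intro h
      have hs : s = 0 := hind s (by
        rw [eq_neg_of_add_eq_zero_left h]; exact neg_mem w.2)
      have hw : w = 0 := by simpa [hs] using h
      rintro ⟨t, v, v'⟩
      rw [hbr]
      simp only [hs, hw, map_zero, smul_zero, zero_smul, sub_zero]
      rfl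
    · intro h
      have h1 := h ((1, 0, 0) : F × W × W)
      rw [hbr] at h1
      have h2 : w = 0 := by simpa using congrArg (fun p : F × W × W => p.2.2) h1
      obtain ⟨v, hv, hv0⟩ := hne
      have h3 := h ((0, ⟨v, hv⟩, 0) : F × W × W)
      rw [hbr] at h3
      have h4 : s = 0 ∨ v = 0 := by simpa using congrArg (fun p : F × W × W => p.2.2) h3
      have h5 : s = 0 := h4.resolve_right hv0
      simp [h2, h5]

/-- Heisenberg type algebra plus an abelian one is capable -/
theorem capable_heis {H A : Type v} [AddCommGroup H] [Module F H] [LieSuper F H]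
    [AddCommGroup A] [Module F A] [LieSuper F A]
    (hA : ∀ x y : A, sbr F x y = 0) (b : ZMod 2) (x y z : H)
    (hx : x ∈ grd F H 0) (hy : y ∈ grd F H b) (hz : z ∈ grd F H b)
    (hsp : ∀ m : H, ∃ r s t : F, m = r • x + (s • y + t • z))
    (hind : ∀ r s t : F, r • x = s • y + t • z → r = 0)
    (hz0 : z ≠ 0)
    (hxx : sbr F x x = 0) (hyy : sbr F y y = 0) (hxy : sbr F x y = z)
    (hzl : ∀ w, sbr F z w = 0) (hzr : ∀ w, sbr F w z = 0) : Capable F (H × A) := by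
  have hbr : ∀ p q : H × A, sbr F p q = (sbr F p.1 q.1, sbr F p.2 q.2) := fun p q => rfl
  have hgr : ∀ (a : ZMod 2) (p : H × A), p ∈ grd F (H × A) a ↔
    p.1 ∈ grd F H a ∧ p.2 ∈ grd F A a := fun a p => Iff.rfl
  let W0 : Submodule F H := Submodule.span F {y, z}
  have hW0 : ∀ w, w ∈ W0 ↔ ∃ s t : F, s • y + t • z = w := fun w => Submodule.mem_span_pair
  refine capable_of_split (x, 0) ?_ (W0.prod ⊤) ?_ ?_ ?_ ?_ ?_ ?_ ?_
  · rw [hgr]; exact ⟨hx, zero_mem _⟩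
  · rintro ⟨u, u'⟩ hu ⟨v, v'⟩ hv huv
    simp only [Prod.mk_add_mk, Submodule.mem_prod, Submodule.mem_top, and_true] at huv ⊢
    rw [hgr] at hu hv
    have hu := hu.1
    have hv := hv.1
    simp only at hu hv
    have hWb : ∀ w ∈ W0, w ∈ grd F H b := by
      intro w hw
      obtain ⟨s, t, rfl⟩ := (hW0 w).1 hw
      exact add_mem (Submodule.smul_mem _ _ hy) (Submodule.smul_mem _ _ hz)
    have h1 := hWb _ huv
    rcases z2 b with rfl | rfl
    · have h2 : v = 0 := gr_inter 0 (by simpa using sub_mem h1 hu) (by simpa using hv)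
      subst h2
      exact ⟨by simpa using huv, zero_mem _⟩
    · have h2 : u = 0 := gr_inter 0 hu (by simpa using sub_mem h1 hv)
      subst h2
      exact ⟨zero_mem _, by simpa using huv⟩
  · rintro ⟨u, u'⟩ hu ⟨v, v'⟩ hv
    rw [hbr]
    obtain ⟨s, t, h1⟩ := (hW0 _).1 hu.1
    obtain ⟨s', t', h2⟩ := (hW0 _).1 hv.1
    simp only at h1 h2
    subst h1 h2
    simp [hA, sbr_add_left, sbr_add_right, sbr_smul_left, sbr_smul_right, hyy, hzl, hzr]
  · rw [hbr]; simp [hxx, hA]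
  · rintro ⟨u, u'⟩ hu
    obtain ⟨s, t, h1⟩ := (hW0 _).1 hu.1
    simp only at h1
    subst h1
    rw [hbr]
    refine ⟨(hW0 _).2 ⟨0, s, ?_⟩, trivial⟩
    simp [sbr_add_right, sbr_smul_right, hxy, hzr]
  · rintro ⟨m, m'⟩
    obtain ⟨r, s, t, rfl⟩ := hsp m
    refine ⟨r, (s • y + t • z, m'), ⟨(hW0 _).2 ⟨s, t, rfl⟩, trivial⟩, ?_⟩
    simp
  · intro s hs
    obtain ⟨p, q, h⟩ := (hW0 _).1 hs.1
    exact hind s p q (by simpa using h.symm)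
  · exact ⟨(z, 0), ⟨(hW0 _).2 ⟨0, 1, by simp⟩, trivial⟩, by simpa using hz0⟩

theorem capable_of_heisE {H A : Type v} [AddCommGroup H] [Module F H] [LieSuper F H]
    [AddCommGroup A] [Module F A] [LieSuper F A] (h : IsHeisE F 1 0 H)
    (hA : ∀ x y : A, sbr F x y = 0) : Capable F (H × A) := by
  obtain ⟨x, y, z, hx, hz, -, hli, hsp, hxx, -, -, -, hzl, hzr⟩ := h
  have e1 := hxx 0 0
  have e2 := hxx 1 1
  have e3 := hxx 0 1
  simp at e1 e2 e3
  refine capable_heis hA 0 (x 0) (x 1) z (hx 0) (hx 1) hz ?_ ?_ ?_ e1 e2 e3 hzl hzr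
  · intro m
    have hm : m ∈ Submodule.span F (Set.range (Sum.elim x (Sum.elim y (fun _ : Unit => z)))) := by
      rw [hsp]; trivial
    rw [Submodule.mem_span_range_iff_exists_fun] at hm
    obtain ⟨c, rfl⟩ := hm
    refine ⟨c (Sum.inl 0), c (Sum.inl 1), c (Sum.inr (Sum.inr ())), ?_⟩
    have := Fin.sum_univ_two (fun i : Fin 2 => c (Sum.inl i) • x i)
    simp only [Fintype.sum_sum_type, Sum.elim_inl, Sum.elim_inr]
    erw [this]
    simp [add_assoc]
  · intro r s t h
    rw [Fintype.linearIndependent_iff] at hli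
    have := hli (Sum.elim ![r, -s] (Sum.elim (fun _ => 0) (fun _ => -t))) ?_ (Sum.inl 0)
    · simpa using this
    · have := Fin.sum_univ_two (fun i : Fin 2 => (![r, -s] i) • x i)
      simp only [Fintype.sum_sum_type, Sum.elim_inl, Sum.elim_inr]
      erw [this]
      simp [h]
  · exact hli.ne_zero (Sum.inr (Sum.inr ()))

theorem capable_of_heisO {H A : Type v} [AddCommGroup H] [Module F H] [LieSuper F H]
    [AddCommGroup A] [Module F A] [LieSuper F A] (h : IsHeisO F 1 H)
    (hA : ∀ x y : A, sbr F x y = 0) : Capable F (H × A) := by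
  obtain ⟨x, y, z, hx, hy, hz, hli, hsp, hxx, hxy, -, hyy, hzl, hzr⟩ := h
  refine capable_heis hA 1 (x 0) (y 0) z (hx 0) (hy 0) hz ?_ ?_ ?_ (hxx 0 0) (hyy 0 0)
    (by simpa using hxy 0 0) hzl hzr
  · intro m
    have hm : m ∈ Submodule.span F (Set.range (Sum.elim x (Sum.elim y (fun _ : Unit => z)))) := by
      rw [hsp]; trivial
    rw [Submodule.mem_span_range_iff_exists_fun] at hm
    obtain ⟨c, rfl⟩ := hm
    refine ⟨c (Sum.inl 0), c (Sum.inr (Sum.inl 0)), c (Sum.inr (Sum.inr ())), ?_⟩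
    simp [Fintype.sum_sum_type]
  · intro r s t h
    rw [Fintype.linearIndependent_iff] at hli
    have := hli (Sum.elim (fun _ => r) (Sum.elim (fun _ => -s) (fun _ => -t))) ?_ (Sum.inl 0)
    · simpa using this
    · simp [Fintype.sum_sum_type, h]
      module
  · exact hli.ne_zero (Sum.inr (Sum.inr ()))

end Construct

section Forward

variable {F : Type u} [Field F] {L : Type v} [AddCommGroup L] [Module F L] [LieSuper F L]

theorem triple_zero {a b c : ZMod 2} {p q h : L} (hp : p ∈ grd F L a) (hq : q ∈ grd F L b)
    (hh : h ∈ grd F L c) (h1 : sbr F q h ∈ centerS F L) (h2 : sbr F h p ∈ centerS F L) :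
    sbr F h (sbr F p q) = 0 := by
  have hj := LieSuper.br_jacobi (F := F) c a b h hh p hp q hq
  have e1 : LieSuper.br (F := F) p (LieSuper.br (F := F) q h) = 0 := center_right h1 p
  have e2 : LieSuper.br (F := F) q (LieSuper.br (F := F) h p) = 0 := center_right h2 q
  rw [e1, e2, smul_zero, smul_zero, add_zero, add_zero] at hj
  exact (smul_eq_zero.1 hj).resolve_left (sg_ne _ _)

theorem cube_zero (hchar3 : (3 : F) ≠ 0) {h : L} (hh : h ∈ grd F L 1) :
    sbr F h (sbr F h h) = 0 := by
  have hj := LieSuper.br_jacobi (F := F) 1 1 1 h hh h hh h hh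
  change sg F 1 1 • sbr F h (sbr F h h) + sg F 1 1 • sbr F h (sbr F h h)
    + sg F 1 1 • sbr F h (sbr F h h) = 0 at hj
  rw [sg_one_one] at hj
  have : (-3 : F) • sbr F h (sbr F h h) = 0 := by
    rw [← hj]; module
  exact (smul_eq_zero.1 this).resolve_left (neg_ne_zero.2 hchar3)

theorem noncap (hchar3 : (3 : F) ≠ 0) (hcap : Capable F L) {d : ZMod 2} {z : L}
    (hz : z ∈ grd F L d) (hz0 : z ≠ 0)
    (hall : ∀ w : L, w ∈ Submodule.span F {c : L |
      (∃ (a b : ZMod 2) (p q : L), p ∈ grd F L a ∧ q ∈ grd F L b ∧ sbr F p q = z ∧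
        sbr F p c = 0 ∧ sbr F q c = 0) ∨ (c ∈ grd F L 1 ∧ sbr F c c = z)}) : False := by
  obtain ⟨H, φ, hφ, hs, hk⟩ := hcap
  have hker : ∀ h : H.carrier, φ h = 0 → h ∈ centerS F H.carrier := by
    intro h hh; rw [← hk]; exact hh
  obtain ⟨zt, hzt, hφz⟩ := hom_lift hφ hs hz
  let K : Submodule F H.carrier :=
    { carrier := {h | sbr F h zt = 0}
      add_mem' := by
        intro a b ha hb
        change sbr F _ _ = 0 at ha hb ⊢
        rw [sbr_add_left, ha, hb, add_zero]
      zero_mem' := sbr_zero_left _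
      smul_mem' := by
        intro c a ha
        change sbr F _ _ = 0 at ha ⊢
        rw [sbr_smul_left, ha, smul_zero] }
  have hKm : ∀ h, h ∈ K ↔ sbr F h zt = 0 := fun h => Iff.rfl
  have hmap : ∀ w : L, w ∈ K.map φ := by
    intro w
    refine (Submodule.span_le.2 ?_) (hall w)
    rintro c (⟨a, b, p, q, hp, hq, hpq, hpc, hqc⟩ | ⟨hc, hcc⟩)
    · obtain ⟨pt, hpt, hpe⟩ := hom_lift hφ hs hp
      obtain ⟨qt, hqt, hqe⟩ := hom_lift hφ hs hq
      have hcen : zt - sbr F pt qt ∈ centerS F H.carrier := by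
        apply hker
        rw [map_sub, hφ.2, hpe, hqe, hφz, hpq, sub_self]
      have key : ∀ (e : ZMod 2) (u : L), u ∈ grd F L e → sbr F p u = 0 → sbr F q u = 0 →
          u ∈ K.map φ := by
        intro e u hu h1 h2
        obtain ⟨ut, hut, hue⟩ := hom_lift hφ hs hu
        refine ⟨ut, ?_, hue⟩
        have h3 : sbr F ut (sbr F pt qt) = 0 := by
          refine triple_zero hpt hqt hut (hker _ ?_) (hker _ ?_)
          · rw [hφ.2, hqe, hue, h2]
          · rw [hφ.2, hpe, hue]; exact comm_zero hp h1
        have h4 := center_right hcen ut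
        rw [sbr_sub_right, h3, sub_zero] at h4
        exact h4
      obtain ⟨u, hu, v, hv, rfl⟩ := gr_decomp F 0 c
      obtain ⟨h1, h2⟩ := comp_zero hp hu hv hpc
      obtain ⟨h3, h4⟩ := comp_zero hq hu hv hqc
      exact add_mem (key _ _ hu h1 h3) (key _ _ hv h2 h4)
    · obtain ⟨ct, hct, hce⟩ := hom_lift hφ hs hc
      refine ⟨ct, ?_, hce⟩
      have hcen : zt - sbr F ct ct ∈ centerS F H.carrier := by
        apply hker
        rw [map_sub, hφ.2, hce, hφz, hcc, sub_self]
      have h4 := center_right hcen ct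
      rw [sbr_sub_right, cube_zero hchar3 hct, sub_zero] at h4
      exact h4
  have hztc : zt ∈ centerS F H.carrier := by
    intro h
    apply comm_zero' hzt
    obtain ⟨h', hh', he⟩ := hmap (φ h)
    have h5 : h - h' ∈ centerS F H.carrier := hker _ (by rw [map_sub, he, sub_self])
    have h6 := h5 zt
    rw [sbr_sub_left, (hKm h').1 hh', sub_zero] at h6
    exact h6
  rw [← hk, LinearMap.mem_ker, hφz] at hztc
  exact hz0 hztc

/-- a graded subalgebra is a Lie superalgebra -/
@[reducible] def subLS (S : Submodule F L)
    (hS : ∀ u ∈ grd F L 0, ∀ v ∈ grd F L 1, u + v ∈ S → u ∈ S ∧ v ∈ S)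
    (hb : ∀ u ∈ S, ∀ v ∈ S, sbr F u v ∈ S) : LieSuper F S where
  gr a := (grd F L a).comap S.subtype
  isCompl_gr := by
    constructor
    · rw [disjoint_iff, eq_bot_iff]
      rintro ⟨w, hw⟩ h
      rw [Submodule.mem_inf] at h
      have : w = 0 := gr_inter (F := F) 0 h.1 (by rw [zero_add]; exact h.2)
      simpa using this
    · rw [codisjoint_iff, eq_top_iff]
      rintro ⟨w, hw⟩ -
      obtain ⟨u, hu, v, hv, rfl⟩ := gr_decomp F 0 w
      rw [zero_add] at hv
      obtain ⟨h1, h2⟩ := hS u hu v hv hw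
      exact Submodule.mem_sup.mpr ⟨⟨u, h1⟩, hu, ⟨v, h2⟩, hv, rfl⟩
  br x y := ⟨sbr F (x : L) (y : L), hb _ x.2 _ y.2⟩
  br_add_left x y z := Subtype.ext (sbr_add_left _ _ _)
  br_add_right x y z := Subtype.ext (sbr_add_right _ _ _)
  br_smul_left c x y := Subtype.ext (sbr_smul_left _ _ _)
  br_smul_right c x y := Subtype.ext (sbr_smul_right _ _ _)
  br_gr a b x hx y hy := sbr_gr (F := F) (L := L) hx hy
  br_skew a b x hx y hy := Subtype.ext (sbr_skew (F := F) (L := L) hx hy)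
  br_jacobi a b c x hx y hy z hz :=
    Subtype.ext (LieSuper.br_jacobi (F := F) (L := L) a b c x hx y hy z hz)

theorem build {b : ZMod 2} {x y z : L} (hx : x ∈ grd F L 0) (hy : y ∈ grd F L b)
    (hxy : sbr F x y = z) (hz0 : z ≠ 0) (hxx : sbr F x x = 0) (hyy : sbr F y y = 0)
    (hzl : ∀ w, sbr F z w = 0) (hzr : ∀ w, sbr F w z = 0)
    (hspan : ∀ u v : L, ∃ c : F, sbr F u v = c • z)
    (hP : ∀ u v : L, sbr F x u = 0 → sbr F y u = 0 → sbr F x v = 0 → sbr F y v = 0 →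
      sbr F u v = 0) [FiniteDimensional F L] :
    ∃ (H A : LieSupAlg.{u, v} F) (x' y' z' : H.carrier),
      x' ∈ grd F H.carrier 0 ∧ y' ∈ grd F H.carrier b ∧ z' ∈ grd F H.carrier b ∧
      (∀ m : H.carrier, ∃ r s t : F, m = r • x' + s • y' + t • z') ∧
      (∀ r s t : F, r • x' + s • y' + t • z' = 0 → r = 0 ∧ s = 0 ∧ t = 0) ∧
      sbr F x' x' = 0 ∧ sbr F y' y' = 0 ∧ sbr F x' y' = z' ∧ sbr F y' x' = -z' ∧
      (∀ w, sbr F z' w = 0) ∧ (∀ w, sbr F w z' = 0) ∧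
      (∀ u v : A.carrier, sbr F u v = 0) ∧ Module.Finite F A.carrier ∧
      Module.Finite F H.carrier ∧
      ∃ e : L ≃ₗ[F] (H.carrier × A.carrier), IsHom F e.toLinearMap := by
  have hz : z ∈ grd F L b := by
    have := sbr_gr hx hy
    rwa [hxy, zero_add] at this
  have hyx : sbr F y x = -z := by
    rw [sbr_skew hy hx, sg_zero_right, hxy]; simp
  have hzn : z ∉ grd F L (b + 1) := fun h => hz0 (gr_inter b hz h)
  obtain ⟨g, hgz, hg⟩ := Submodule.exists_le_ker_of_notMem hzn
  have hg' : ∀ w ∈ grd F L (b + 1), g w = 0 := fun w hw => hg hw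
  have hind : ∀ r s t : F, sbr F x (r • x + s • y + t • z) = 0 →
      sbr F y (r • x + s • y + t • z) = 0 → g (r • x + s • y + t • z) = 0 →
      r = 0 ∧ s = 0 ∧ t = 0 := by
    intro r s t h1 h2 h3
    simp only [sbr_add_right, sbr_smul_right, hxx, hxy, hyx, hyy, hzr] at h1 h2
    have hs : s = 0 := by simpa [hz0] using h1
    have hr : r = 0 := by simpa [hz0] using h2
    have ht : t = 0 := by simpa [hr, hs, hgz] using h3
    exact ⟨hr, hs, ht⟩
  let S : Submodule F L := Submodule.span F {x, y, z}
  have hSm : ∀ w, w ∈ S ↔ ∃ r s t : F, r • x + s • y + t • z = w :=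
    fun w => Submodule.mem_span_triple
  have hxS : x ∈ S := (hSm _).2 ⟨1, 0, 0, by simp⟩
  have hyS : y ∈ S := (hSm _).2 ⟨0, 1, 0, by simp⟩
  have hzS : z ∈ S := (hSm _).2 ⟨0, 0, 1, by simp⟩
  let C : Submodule F L :=
    { carrier := {w | sbr F x w = 0 ∧ sbr F y w = 0 ∧ g w = 0}
      add_mem' := by
        rintro p q ⟨h1, h2, h3⟩ ⟨h4, h5, h6⟩
        refine ⟨?_, ?_, ?_⟩
        · rw [sbr_add_right, h1, h4, add_zero]
        · rw [sbr_add_right, h2, h5, add_zero]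
        · rw [map_add, h3, h6, add_zero]
      zero_mem' := ⟨sbr_zero_right _, sbr_zero_right _, map_zero _⟩
      smul_mem' := by
        rintro c p ⟨h1, h2, h3⟩
        refine ⟨?_, ?_, ?_⟩
        · rw [sbr_smul_right, h1, smul_zero]
        · rw [sbr_smul_right, h2, smul_zero]
        · rw [map_smul, h3, smul_zero] }
  have hCm : ∀ w, w ∈ C ↔ sbr F x w = 0 ∧ sbr F y w = 0 ∧ g w = 0 := fun w => Iff.rfl
  have hSgr : ∀ u ∈ grd F L 0, ∀ v ∈ grd F L 1, u + v ∈ S → u ∈ S ∧ v ∈ S := by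
    intro u hu v hv huv
    suffices h : u ∈ S by
      refine ⟨h, ?_⟩
      have := sub_mem huv h
      simpa using this
    obtain ⟨r, s, t, h⟩ := (hSm _).1 huv
    rcases z2 b with rfl | rfl
    · have h1 : u + v ∈ grd F L 0 := by
        rw [← h]
        exact add_mem (add_mem (Submodule.smul_mem _ _ hx) (Submodule.smul_mem _ _ hy))
          (Submodule.smul_mem _ _ hz)
      have h2 : v = 0 := gr_inter (F := F) 0 (by simpa using sub_mem h1 hu) (by simpa using hv)
      simpa [h2] using huv
    · have h1 : u - r • x = 0 := by
        refine gr_inter (F := F) 0 (sub_mem hu (Submodule.smul_mem _ _ hx)) ?_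
        have : u - r • x = s • y + t • z - v := by
          have : u = r • x + s • y + t • z - v := by rw [h]; abel
          rw [this]; abel
        rw [this, zero_add]
        exact sub_mem (add_mem (Submodule.smul_mem _ _ hy) (Submodule.smul_mem _ _ hz)) hv
      rw [sub_eq_zero.1 h1]
      exact Submodule.smul_mem _ _ hxS
  have hCgr : ∀ u ∈ grd F L 0, ∀ v ∈ grd F L 1, u + v ∈ C → u ∈ C ∧ v ∈ C := by
    intro u hu v hv huv
    obtain ⟨h1, h2, h3⟩ := (hCm _).1 huv
    have hv' : v ∈ grd F L (0 + 1) := by rwa [zero_add]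
    obtain ⟨h4, h5⟩ := comp_zero hx hu hv' h1
    obtain ⟨h6, h7⟩ := comp_zero hy hu hv' h2
    have h8 : g u = 0 ∧ g v = 0 := by
      rw [map_add] at h3
      rcases z2 b with rfl | rfl
      · have := hg' v hv'
        exact ⟨by simpa [this] using h3, this⟩
      · have := hg' u hu
        exact ⟨this, by simpa [this] using h3⟩
    exact ⟨⟨h4, h6, h8.1⟩, ⟨h5, h7, h8.2⟩⟩
  have hSb : ∀ u ∈ S, ∀ v ∈ S, sbr F u v ∈ S := by
    intro u _ v _
    obtain ⟨c, hc⟩ := hspan u v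
    rw [hc]; exact Submodule.smul_mem _ _ hzS
  have hCC : ∀ u ∈ C, ∀ v ∈ C, sbr F u v = 0 :=
    fun u hu v hv => hP u v hu.1 hu.2.1 hv.1 hv.2.1
  have hCb : ∀ u ∈ C, ∀ v ∈ C, sbr F u v ∈ C := by
    intro u hu v hv
    rw [hCC u hu v hv]; exact zero_mem _
  have hSC : ∀ u ∈ S, ∀ v ∈ C, sbr F u v = 0 ∧ sbr F v u = 0 := by
    intro u hu v hv
    obtain ⟨r, s, t, rfl⟩ := (hSm _).1 hu
    simp only [sbr_add_left, sbr_add_right, sbr_smul_left, sbr_smul_right, hzl, hzr, hv.1, hv.2.1,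
      comm_zero hx hv.1, comm_zero hy hv.2.1]
    simp
  have hcompl : IsCompl S C := by
    constructor
    · rw [disjoint_iff, eq_bot_iff]
      intro w hw
      obtain ⟨h1, h2, h3, h4⟩ := hw
      obtain ⟨r, s, t, rfl⟩ := (hSm _).1 h1
      obtain ⟨rfl, rfl, rfl⟩ := hind r s t h2 h3 h4
      simp
    · rw [codisjoint_iff, eq_top_iff]
      intro w _
      obtain ⟨s, hs⟩ := hspan x w
      obtain ⟨r, hr⟩ := hspan y w
      let p := w + r • x - s • y
      let t := g p / g z
      refine Submodule.mem_sup.mpr ⟨(-r) • x + s • y + t • z, (hSm _).2 ⟨_, _, _, rfl⟩,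
        p - t • z, ?_, ?_⟩
      · refine ⟨?_, ?_, ?_⟩
        · simp only [p, sbr_sub_right, sbr_add_right, sbr_smul_right, hs, hxx, hxy, hzr]
          simp
        · simp only [p, sbr_sub_right, sbr_add_right, sbr_smul_right, hr, hyx, hyy, hzr]
          simp
        · rw [map_sub, map_smul, smul_eq_mul, div_mul_cancel₀ _ hgz, sub_self]
      · simp only [p]; module
  letI iS : LieSuper F S := subLS S hSgr hSb
  letI iC : LieSuper F C := subLS C hCgr hCb
  let e : (S × C) ≃ₗ[F] L := Submodule.prodEquivOfIsCompl S C hcompl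
  have he : ∀ p : S × C, e p = (p.1 : L) + (p.2 : L) := fun p => by
    exact Submodule.coe_prodEquivOfIsCompl' S C hcompl p
  have hehom : IsHom F e.toLinearMap := by
    constructor
    · intro a p hp
      change e p ∈ _
      rw [he p]
      exact add_mem hp.1 hp.2
    · intro p q
      change e _ = sbr F (e p) (e q)
      have h1 : e (sbr F p q) = sbr F (p.1 : S).1 (q.1 : S).1 + sbr F (p.2 : C).1 (q.2 : C).1 :=
        he _
      rw [h1, he p, he q]
      simp only [sbr_add_left, sbr_add_right]
      rw [(hSC _ (p.1 : S).2 _ (q.2 : C).2).1, (hSC _ (q.1 : S).2 _ (p.2 : C).2).2]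
      simp
  refine ⟨{ carrier := S, ils := iS }, { carrier := C, ils := iC }, (⟨x, hxS⟩ : S), (⟨y, hyS⟩ : S), (⟨z, hzS⟩ : S), hx, hy, hz, ?_, ?_, Subtype.ext hxx,
    Subtype.ext hyy, Subtype.ext hxy, Subtype.ext hyx, fun w => Subtype.ext (hzl _),
    fun w => Subtype.ext (hzr _), fun u v => Subtype.ext (hCC _ (u : C).2 _ (v : C).2),
    inferInstanceAs (Module.Finite F C), inferInstanceAs (Module.Finite F S), e.symm, hom_symm hehom⟩
  · rintro ⟨m, hm⟩
    obtain ⟨r, s, t, h⟩ := (hSm _).1 hm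
    exact ⟨r, s, t, Subtype.ext h.symm⟩
  · intro r s t h
    have h' : r • x + s • y + t • z = 0 := congrArg (Subtype.val (p := fun w => w ∈ S)) h
    apply hind <;> rw [h']
    · exact sbr_zero_right _
    · exact sbr_zero_right _
    · exact map_zero _

theorem finrank_gr_prod {H A : Type v} [AddCommGroup H] [Module F H] [LieSuper F H]
    [AddCommGroup A] [Module F A] [LieSuper F A] [Module.Finite F H] [Module.Finite F A]
    (e : L ≃ₗ[F] (H × A)) (he : IsHom F e.toLinearMap) (a : ZMod 2) :
    finrank F (grd F L a) = finrank F (grd F H a) + finrank F (grd F A a) := by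
  have h1 : (grd F L a).map e.toLinearMap = grd F (H × A) a := by
    ext p
    constructor
    · rintro ⟨w, hw, rfl⟩; exact he.1 _ _ hw
    · intro hp
      obtain ⟨w, hw, h⟩ := hom_lift he e.surjective hp
      exact ⟨w, hw, h⟩
  have h2 : finrank F (grd F L a) = finrank F (grd F (H × A) a) := by
    rw [← h1]; exact (e.finrank_map_eq _).symm
  have h3 : grd F (H × A) a = (grd F H a).prod (grd F A a) := rfl
  rw [h2, h3, ← Module.finrank_prod]
  exact LinearEquiv.finrank_eq
    { toFun := fun p => (⟨p.1.1, p.2.1⟩, ⟨p.1.2, p.2.2⟩)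
      invFun := fun p => ⟨(p.1.1, p.2.1), p.1.2, p.2.2⟩
      map_add' := fun _ _ => rfl
      map_smul' := fun _ _ => rfl
      left_inv := fun _ => rfl
      right_inv := fun _ => rfl }

end Forward

section Main

variable {F : Type u} [Field F] {L : Type v} [AddCommGroup L] [Module F L] [LieSuper F L]

theorem facts (hnilp : IsNilp F L) (hder : Module.finrank F ↥(derived F L) = 1)
    {a b : ZMod 2} {x y z : L} (hx : x ∈ grd F L a) (hy : y ∈ grd F L b)
    (hxy : sbr F x y = z) (hz0 : z ≠ 0) :
    (∀ u v : L, ∃ c : F, sbr F u v = c • z) ∧ (∀ w, sbr F z w = 0) ∧ (∀ w, sbr F w z = 0) := by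
  have hm : ∀ u v : L, sbr F u v ∈ derived F L := fun u v =>
    Submodule.subset_span ⟨u, trivial, v, trivial, rfl⟩
  have hsp : ∀ u v : L, ∃ c : F, sbr F u v = c • z := by
    intro u v
    have hz : z ∈ derived F L := hxy ▸ hm x y
    have hne : (⟨z, hz⟩ : derived F L) ≠ 0 := fun h => hz0 (congrArg Subtype.val h)
    obtain ⟨c, hc⟩ := (finrank_eq_one_iff_of_nonzero' _ hne).1 hder ⟨_, hm u v⟩
    exact ⟨c, (congrArg Subtype.val hc).symm⟩
  have hzl : ∀ w, sbr F z w = 0 := by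
    intro w
    obtain ⟨c, hc⟩ := hsp z w
    by_cases h0 : c = 0
    · rw [hc, h0, zero_smul]
    exfalso
    obtain ⟨n, hn⟩ := hnilp
    have hall : ∀ m, z ∈ lowerCentral F L m := by
      intro m
      induction m with
      | zero => exact Submodule.mem_top
      | succ m ih =>
        have h1 : sbr F z w ∈ lowerCentral F L (m + 1) :=
          Submodule.subset_span ⟨z, ih, w, trivial, rfl⟩
        rw [hc] at h1
        have := Submodule.smul_mem _ c⁻¹ h1
        rwa [smul_smul, inv_mul_cancel₀ h0, one_smul] at this
    have := hall n
    rw [hn] at this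
    exact hz0 (by simpa using this)
  exact ⟨hsp, hzl, fun w => comm_zero (a := a + b) (hxy ▸ sbr_gr hx hy) (hzl w)⟩

theorem isHeisE_of {H : Type v} [AddCommGroup H] [Module F H] [LieSuper F H] {x y z : H}
    (hx : x ∈ grd F H 0) (hy : y ∈ grd F H 0) (hz : z ∈ grd F H 0)
    (hsp : ∀ m : H, ∃ r s t : F, m = r • x + s • y + t • z)
    (hind : ∀ r s t : F, r • x + s • y + t • z = 0 → r = 0 ∧ s = 0 ∧ t = 0)
    (hxx : sbr F x x = 0) (hyy : sbr F y y = 0) (hxy : sbr F x y = z) (hyx : sbr F y x = -z)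
    (hzl : ∀ w, sbr F z w = 0) (hzr : ∀ w, sbr F w z = 0) : IsHeisE F 1 0 H := by
  have hsum : ∀ c : Fin 2 ⊕ (Fin 0 ⊕ Unit) → F,
      ∑ i, c i • (Sum.elim ![x, y] (Sum.elim (![] : Fin 0 → H) (fun _ : Unit => z))) i =
      c (Sum.inl 0) • x + c (Sum.inl 1) • y + c (Sum.inr (Sum.inr ())) • z := by
    intro c
    simp [Fintype.sum_sum_type]
  refine ⟨(![x, y] : Fin 2 → H), ![], z, ?_, hz, fun j => j.elim0, ?_, ?_, ?_, ?_, ?_,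
    fun i => i.elim0, hzl, hzr⟩
  · intro i
    change Fin 2 at i
    fin_cases i
    · exact hx
    · exact hy
  · apply Fintype.linearIndependent_iff.2
    intro c hc
    erw [hsum c] at hc
    obtain ⟨h1, h2, h3⟩ := hind _ _ _ hc
    rintro (i | i | i)
    · change Fin 2 at i
      fin_cases i
      · exact h1
      · exact h2
    · exact i.elim0
    · exact h3
  · rw [eq_top_iff]
    intro m _
    apply (Submodule.mem_span_range_iff_exists_fun F).2
    obtain ⟨r, s, t, rfl⟩ := hsp m
    refine ⟨(Sum.elim ![r, s] (Sum.elim (![] : Fin 0 → F) (fun _ : Unit => t)) :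
      Fin 2 ⊕ (Fin 0 ⊕ Unit) → F), ?_⟩
    erw [hsum]
    simp
  · intro i j
    change Fin 2 at i j
    fin_cases i <;> fin_cases j <;> simp [hxx, hyy, hxy, hyx]
  · intro i j
    exact j.elim0
  · intro i j
    exact j.elim0

theorem isHeisO_of {H : Type v} [AddCommGroup H] [Module F H] [LieSuper F H] {x y z : H}
    (hx : x ∈ grd F H 0) (hy : y ∈ grd F H 1) (hz : z ∈ grd F H 1)
    (hsp : ∀ m : H, ∃ r s t : F, m = r • x + s • y + t • z)
    (hind : ∀ r s t : F, r • x + s • y + t • z = 0 → r = 0 ∧ s = 0 ∧ t = 0)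
    (hxx : sbr F x x = 0) (hyy : sbr F y y = 0) (hxy : sbr F x y = z) (hyx : sbr F y x = -z)
    (hzl : ∀ w, sbr F z w = 0) (hzr : ∀ w, sbr F w z = 0) : IsHeisO F 1 H := by
  refine ⟨fun _ => x, fun _ => y, z, fun _ => hx, fun _ => hy, hz, ?_, ?_, fun _ _ => hxx, ?_, ?_,
    fun _ _ => hyy, hzl, hzr⟩
  · apply Fintype.linearIndependent_iff.2
    intro c hc
    simp [Fintype.sum_sum_type] at hc
    rw [← add_assoc] at hc
    obtain ⟨h1, h2, h3⟩ := hind _ _ _ hc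
    rintro (i | i | i)
    · rw [Subsingleton.elim i 0]; exact h1
    · rw [Subsingleton.elim i 0]; exact h2
    · exact h3
  · rw [eq_top_iff]
    intro m _
    apply (Submodule.mem_span_range_iff_exists_fun F).2
    obtain ⟨r, s, t, rfl⟩ := hsp m
    refine ⟨Sum.elim (fun _ => r) (Sum.elim (fun _ => s) (fun _ => t)), ?_⟩
    simp [Fintype.sum_sum_type, add_assoc]
  · intro i j
    simp [Subsingleton.elim i j, hxy]
  · intro i j
    simp [Subsingleton.elim i j, hyx]

theorem finrank_three {H : Type v} [AddCommGroup H] [Module F H] {x y z : H}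
    (hsp : ∀ m : H, ∃ r s t : F, m = r • x + s • y + t • z)
    (hind : ∀ r s t : F, r • x + s • y + t • z = 0 → r = 0 ∧ s = 0 ∧ t = 0) :
    finrank F H = 3 := by
  have hli : LinearIndependent F ![x, y, z] := by
    apply Fintype.linearIndependent_iff.2
    intro c hc
    simp [Fin.sum_univ_three] at hc
    obtain ⟨h1, h2, h3⟩ := hind _ _ _ hc
    intro i
    fin_cases i
    · exact h1
    · exact h2
    · exact h3
  have htop : ⊤ ≤ Submodule.span F (Set.range ![x, y, z]) := by
    intro m _
    apply (Submodule.mem_span_range_iff_exists_fun F).2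
    obtain ⟨r, s, t, rfl⟩ := hsp m
    exact ⟨![r, s, t], by simp [Fin.sum_univ_three]⟩
  simpa using finrank_eq_card_basis (Basis.mk hli htop)

theorem finrank_gr_add {H : Type v} [AddCommGroup H] [Module F H] [LieSuper F H]
    [Module.Finite F H] : finrank F (grd F H 0) + finrank F (grd F H 1) = finrank F H :=
  Submodule.finrank_add_eq_of_isCompl (LieSuper.isCompl_gr)

theorem forward_main (hchar2 : (2 : F) ≠ 0) (hchar3 : (3 : F) ≠ 0)
    [FiniteDimensional F L] (hnilp : IsNilp F L)
    (hder : Module.finrank F ↥(derived F L) = 1) (hcap : Capable F L) :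
    ∃ (b : ZMod 2) (x y z : L), x ∈ grd F L 0 ∧ y ∈ grd F L b ∧ sbr F x y = z ∧ z ≠ 0 ∧
      sbr F x x = 0 ∧ sbr F y y = 0 ∧ (∀ w, sbr F z w = 0) ∧ (∀ w, sbr F w z = 0) ∧
      (∀ u v : L, ∃ c : F, sbr F u v = c • z) ∧
      (∀ u v : L, sbr F x u = 0 → sbr F y u = 0 → sbr F x v = 0 → sbr F y v = 0 →
        sbr F u v = 0) := by
  have hsq : ∀ y ∈ grd F L 1, sbr F y y = 0 := by
    intro y hy
    by_contra h0
    obtain ⟨hsp, hzl, hzr⟩ := facts hnilp hder hy hy rfl h0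
    refine noncap hchar3 hcap (sbr_gr hy hy) h0 ?_
    intro w
    obtain ⟨c, hc⟩ := hsp y w
    have hw : w = c • y + (w - c • y) := by abel
    rw [hw]
    refine add_mem (Submodule.smul_mem _ _ (Submodule.subset_span (Or.inr ⟨hy, rfl⟩)))
      (Submodule.subset_span (Or.inl ⟨1, 1, y, y, hy, hy, rfl, ?_, ?_⟩)) <;>
    rw [sbr_sub_right, sbr_smul_right, hc, sub_self]
  have hoo : ∀ x ∈ grd F L 1, ∀ y ∈ grd F L 1, sbr F x y = 0 := by
    intro x hx y hy
    have h1 := hsq _ (add_mem hx hy)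
    have h2 := sbr_skew hy hx
    rw [sg_one_one, neg_neg, one_smul] at h2
    simp only [sbr_add_left, sbr_add_right, hsq x hx, hsq y hy, h2] at h1
    have h3 : (2 : F) • sbr F x y = 0 := by rw [← h1]; module
    exact (smul_eq_zero.1 h3).resolve_left hchar2
  have hee : ∀ x ∈ grd F L 0, sbr F x x = 0 := by
    intro x hx
    have h2 := sbr_skew hx hx
    rw [sg_zero_left] at h2
    have h3 : (2 : F) • sbr F x x = 0 := by
      rw [two_smul]; nth_rewrite 1 [h2]; simp
    exact (smul_eq_zero.1 h3).resolve_left hchar2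
  have hhh : ∀ a, ∀ x ∈ grd F L a, sbr F x x = 0 := by
    intro a x hx
    rcases z2 a with rfl | rfl
    · exact hee x hx
    · exact hsq x hx
  have hex : ∃ (b : ZMod 2) (x y : L), x ∈ grd F L 0 ∧ y ∈ grd F L b ∧ sbr F x y ≠ 0 := by
    by_contra hno
    push Not at hno
    have hz : ∀ u v : L, sbr F u v = 0 := by
      intro u v
      obtain ⟨u0, hu0, u1, hu1, rfl⟩ := gr_decomp F 0 u
      obtain ⟨v0, hv0, v1, hv1, rfl⟩ := gr_decomp F 0 v
      rw [zero_add] at hu1 hv1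
      simp only [sbr_add_left, sbr_add_right]
      rw [hno _ _ _ hu0 hv0, hno _ _ _ hu0 hv1, hoo _ hu1 _ hv1,
        comm_zero_h hv0 hu1 (hno _ _ _ hv0 hu1)]
      simp
    have hbot : derived F L = ⊥ := by
      unfold derived bracketSpan
      rw [Submodule.span_eq_bot]
      rintro _ ⟨u, -, v, -, rfl⟩
      exact hz u v
    rw [hbot] at hder
    simp at hder
  obtain ⟨b, x, y, hx, hy, h0⟩ := hex
  obtain ⟨hsp, hzl, hzr⟩ := facts hnilp hder hx hy rfl h0
  have hxx := hee x hx
  have hyy := hhh b y hy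
  have hyx : sbr F y x = -sbr F x y := by
    rw [sbr_skew hy hx, sg_zero_right]; simp
  have hP : ∀ (a c : ZMod 2) (u v : L), u ∈ grd F L a → v ∈ grd F L c →
      sbr F x u = 0 → sbr F y u = 0 → sbr F x v = 0 → sbr F y v = 0 → sbr F u v = 0 := by
    intro a c u v hu hv h1 h2 h3 h4
    by_contra hne
    obtain ⟨d, hd⟩ := hsp u v
    have hd0 : d ≠ 0 := by
      rintro rfl; exact hne (by rw [hd, zero_smul])
    refine noncap hchar3 hcap (sbr_gr hx hy) h0 ?_
    have huv : sbr F (d⁻¹ • u) v = sbr F x y := by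
      rw [sbr_smul_left, hd, smul_smul, inv_mul_cancel₀ hd0, one_smul]
    intro w
    obtain ⟨s, hs⟩ := hsp x w
    obtain ⟨r, hr⟩ := hsp y w
    have hw : w = (-r) • x + s • y + (w + r • x - s • y) := by module
    rw [hw]
    refine add_mem (add_mem (Submodule.smul_mem _ _ (Submodule.subset_span
      (Or.inl ⟨a, c, d⁻¹ • u, v, Submodule.smul_mem _ _ hu, hv, huv, ?_, ?_⟩)))
      (Submodule.smul_mem _ _ (Submodule.subset_span
      (Or.inl ⟨a, c, d⁻¹ • u, v, Submodule.smul_mem _ _ hu, hv, huv, ?_, ?_⟩))))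
      (Submodule.subset_span (Or.inl ⟨0, b, x, y, hx, hy, rfl, ?_, ?_⟩))
    · rw [sbr_smul_left, comm_zero hx h1, smul_zero]
    · exact comm_zero hx h3
    · rw [sbr_smul_left, comm_zero hy h2, smul_zero]
    · exact comm_zero hy h4
    · simp only [sbr_sub_right, sbr_add_right, sbr_smul_right, hs, hxx]
      simp
    · simp only [sbr_sub_right, sbr_add_right, sbr_smul_right, hr, hyx, hyy]
      simp
  refine ⟨b, x, y, _, hx, hy, rfl, h0, hxx, hyy, hzl, hzr, hsp, ?_⟩
  intro u v h1 h2 h3 h4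
  obtain ⟨u0, hu0, u1, hu1, rfl⟩ := gr_decomp F 0 u
  obtain ⟨v0, hv0, v1, hv1, rfl⟩ := gr_decomp F 0 v
  obtain ⟨a1, a2⟩ := comp_zero hx hu0 hu1 h1
  obtain ⟨a3, a4⟩ := comp_zero hy hu0 hu1 h2
  obtain ⟨a5, a6⟩ := comp_zero hx hv0 hv1 h3
  obtain ⟨a7, a8⟩ := comp_zero hy hv0 hv1 h4
  simp only [sbr_add_left, sbr_add_right]
  rw [hP _ _ _ _ hu0 hv0 a1 a3 a5 a7, hP _ _ _ _ hu0 hv1 a1 a3 a6 a8,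
    hP _ _ _ _ hu1 hv0 a2 a4 a5 a7, hP _ _ _ _ hu1 hv1 a2 a4 a6 a8]
  simp

end Main

/-- let `L` be a finite-dimensional nilpotent Lie superalgebra of
superdimension `(k | l)` whose derived subalgebra has dimension one.  Then `L`
is capable if and only if `L ≅ H(1,0) ⊕ A(k−3 | l)` or `L ≅ H₁ ⊕ A(k−1 | l−2)`. -/
theorem capable_of_dim_derived_one (F : Type u) [Field F]
    (hchar2 : (2 : F) ≠ 0) (hchar3 : (3 : F) ≠ 0)
    (k l : ℕ)
    (L : Type v) [AddCommGroup L] [Module F L] [LieSuper F L]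
    [FiniteDimensional F L] (hnilp : IsNilp F L)
    (hk : Module.finrank F ↥(grd F L 0) = k)
    (hl : Module.finrank F ↥(grd F L 1) = l)
    (hder : Module.finrank F ↥(derived F L) = 1) :
    Capable F L ↔
      ((∃ (H A : LieSupAlg.{u, v} F), IsHeisE F 1 0 H.carrier ∧
          IsAbelSuper F (k - 3) l A.carrier ∧
          ∃ e : L ≃ₗ[F] (H.carrier × A.carrier), IsHom F e.toLinearMap) ∨
       (∃ (H A : LieSupAlg.{u, v} F), IsHeisO F 1 H.carrier ∧
          IsAbelSuper F (k - 1) (l - 2) A.carrier ∧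
          ∃ e : L ≃ₗ[F] (H.carrier × A.carrier), IsHom F e.toLinearMap)) := by
  constructor
  · intro hcap
    obtain ⟨b, x, y, z, hx, hy, hxy, hz0, hxx, hyy, hzl, hzr, hsp, hP⟩ :=
      forward_main hchar2 hchar3 hnilp hder hcap
    obtain ⟨H, A, x', y', z', hx', hy', hz', hsp', hind', hxx', hyy', hxy', hyx', hzl', hzr',
      hA, hfA, hfH, e, he⟩ := build hx hy hxy hz0 hxx hyy hzl hzr hsp hP
    have h3 := finrank_three hsp' hind'
    have h4 := finrank_gr_add (F := F) (H := H.carrier)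
    have h5 := finrank_gr_prod e he 0
    have h6 := finrank_gr_prod e he 1
    rcases z2 b with rfl | rfl
    · left
      have htop : grd F H.carrier 0 = ⊤ := by
        rw [eq_top_iff]
        intro m _
        obtain ⟨r, s, t, rfl⟩ := hsp' m
        exact add_mem (add_mem (Submodule.smul_mem _ _ hx') (Submodule.smul_mem _ _ hy'))
          (Submodule.smul_mem _ _ hz')
      have h7 : finrank F (grd F H.carrier 0) = 3 := by rw [htop, finrank_top, h3]
      exact ⟨H, A, isHeisE_of hx' hy' hz' hsp' hind' hxx' hyy' hxy' hyx' hzl' hzr',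
        ⟨hA, hfA, by omega, by omega⟩, e, he⟩
    · right
      have hx0 : x' ≠ 0 := by
        intro h
        have := (hind' 1 0 0 (by simp [h])).1
        exact one_ne_zero this
      have hspn : grd F H.carrier 0 = Submodule.span F {x'} := by
        apply le_antisymm
        · intro m hm
          obtain ⟨r, s, t, rfl⟩ := hsp' m
          rw [add_assoc] at hm ⊢
          have h8 : s • y' + t • z' = 0 := by
            refine gr_inter (F := F) 0 ?_ ?_
            · have := sub_mem hm (Submodule.smul_mem _ r hx')
              simpa using this
            · rw [zero_add]
              exact add_mem (Submodule.smul_mem _ _ hy') (Submodule.smul_mem _ _ hz')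
          rw [h8, add_zero]
          exact Submodule.smul_mem _ _ (Submodule.mem_span_singleton_self _)
        · rw [Submodule.span_singleton_le_iff_mem]; exact hx'
      have h7 : finrank F (grd F H.carrier 0) = 1 := by
        rw [hspn, finrank_span_singleton hx0]
      exact ⟨H, A, isHeisO_of hx' hy' hz' hsp' hind' hxx' hyy' hxy' hyx' hzl' hzr',
        ⟨hA, hfA, by omega, by omega⟩, e, he⟩
  · rintro (⟨H, A, hH, hA, e, he⟩ | ⟨H, A, hH, hA, e, he⟩)
    · exact capable_transfer he (capable_of_heisE hH hA.1)
    · exact capable_transfer he (capable_of_heisO hH hA.1)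

end SuperLie
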